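/- Let f : ℝ → ℝ be continuous with compact support and σ_f ≥ 0 fixed. Then (2π)^{1/2} κ^{−1/2} L_{f,κ/(2π),σ_f} → N(0, ∫_ℝ f(x)² dx) in distribution as κ → ∞. -/

import Mathlib

open MeasureTheory ProbabilityTheory Real Filter Topology

/-- The complexified compensated Poisson exponent. -/
noncomputable def auxJ (f : ℝ → ℝ) (z : ℂ) : ℂ :=
  ∫ x : ℝ, (Complex.exp (-z * f x) - 1 + z * f x)

lemma auxJ_ofReal (f : ℝ → ℝ) (t : ℝ) :
    auxJ f t = ((∫ x : ℝ, (Real.exp (-t * f x) - 1 + t * f x) : ℝ) : ℂ) := by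
  rw [auxJ, ← integral_complex_ofReal]
  congr 1
  ext x
  push_cast
  rfl

lemma auxJ_differentiable (f : ℝ → ℝ) (hf : Continuous f) (hsupp : HasCompactSupport f) :
    Differentiable ℂ (auxJ f) := by
  have hK : IsCompact (tsupport f) := hsupp
  set ν : Measure ℝ := volume.restrict (tsupport f) with hν
  have hfin : IsFiniteMeasure ν := ⟨by
    rw [hν, Measure.restrict_apply_univ]; exact hK.measure_lt_top⟩
  obtain ⟨C, hC⟩ := hsupp.exists_bound_of_continuous hf
  have hset : integrableExpSet (fun x => -f x) ν = Set.univ := by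
    ext t
    simp only [integrableExpSet, Set.mem_univ, iff_true]
    refine integrable_exp_mul_of_mem_Icc (a := -C) (b := C) (by fun_prop) ?_
    refine Eventually.of_forall fun x => ?_
    have := abs_le.1 (hC x)
    constructor <;> linarith [this.1, this.2]
  have hfi : Integrable f := hf.integrable_of_hasCompactSupport hsupp
  have key : auxJ f = fun z => complexMGF (fun x => -f x) ν z - (ν.real Set.univ : ℂ)
      + z * ∫ x, (f x : ℂ) ∂ν := by
    ext z
    have h1 : auxJ f z = ∫ x, (Complex.exp (-z * f x) - 1 + z * f x) ∂ν := by
      rw [auxJ, hν, setIntegral_eq_integral_of_forall_compl_eq_zero]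
      intro x hx
      simp [image_eq_zero_of_notMem_tsupport hx]
    have hi1 : Integrable (fun x => Complex.exp (-z * f x)) ν := by
      refine ContinuousOn.integrableOn_compact hK ?_
      fun_prop
    have hi2 : Integrable (fun x => (f x : ℂ)) ν := (hfi.restrict).ofReal
    have hi3 : Integrable (fun x => Complex.exp (-z * f x) - 1) ν :=
      hi1.sub (integrable_const _)
    rw [h1, integral_add hi3 (hi2.const_mul z),
      integral_sub hi1 (integrable_const _), integral_const_mul, complexMGF]
    simp
  rw [key]
  have hd : Differentiable ℂ (complexMGF (fun x => -f x) ν) := by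
    intro z
    exact (hasDerivAt_complexMGF (by simp [hset])).differentiableAt
  fun_prop

lemma complexMGF_eq_of_mgf_eq (μ : Measure ℝ) [IsProbabilityMeasure μ] (G : ℂ → ℂ)
    (hG : Differentiable ℂ G) (g : ℝ → ℝ) (hg : ∀ t : ℝ, G t = g t) (hpos : ∀ t, 0 < g t)
    (h : ∀ t : ℝ, ∫ x, Real.exp (t * x) ∂μ = g t) : complexMGF id μ = G := by
  have hset : integrableExpSet id μ = Set.univ := by
    ext t
    simp only [integrableExpSet, Set.mem_univ, iff_true]
    by_contra hn
    have := h t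
    have h0 : ∫ x, Real.exp (t * x) ∂μ = 0 := integral_undef hn
    exact (hpos t).ne (h0.symm.trans this)
  have hd : Differentiable ℂ (complexMGF id μ) := by
    intro z
    exact (hasDerivAt_complexMGF (by simp [hset])).differentiableAt
  have h_real : ∃ᶠ (x : ℝ) in 𝓝[≠] (0 : ℝ), complexMGF id μ x = G x := by
    refine Frequently.of_forall fun y ↦ ?_
    rw [complexMGF_ofReal, hg, ← h y]
    rfl
  refine AnalyticOnNhd.eq_of_frequently_eq (z₀ := ((0 : ℝ) : ℂ))
    (fun z _ => hd.analyticAt z) (fun z _ => hG.analyticAt z) ?_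
  rw [frequently_iff_seq_forall] at h_real ⊢
  obtain ⟨xs, hx_tendsto, hx_eq⟩ := h_real
  refine ⟨fun n ↦ xs n, ?_, fun n ↦ ?_⟩
  · rw [tendsto_nhdsWithin_iff] at hx_tendsto ⊢
    constructor
    · rw [tendsto_ofReal_iff]
      exact hx_tendsto.1
    · simpa using hx_tendsto.2
  · simp [hx_eq]

lemma auxJ_bound (f : ℝ → ℝ) (hf : Continuous f) (hsupp : HasCompactSupport f) :
    ∃ C D : ℝ, ∀ z : ℂ,
      ‖auxJ f z - z ^ 2 / 2 * ((∫ x, f x ^ 2 : ℝ) : ℂ)‖ ≤ ‖z‖ ^ 3 * Real.exp (‖z‖ * C) * D := by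
  obtain ⟨C, hC⟩ := hsupp.exists_bound_of_continuous hf
  refine ⟨C, ∫ x, |f x| ^ 3, fun z => ?_⟩
  have hcs (g : ℝ → ℂ) (hg : Continuous g) (h0 : ∀ x, f x = 0 → g x = 0) : Integrable g := by
    refine hg.integrable_of_hasCompactSupport (hsupp.mono ?_)
    intro x hx hx0
    exact hx (h0 x hx0)
  have hi1 : Integrable (fun x => Complex.exp (-z * f x) - 1 + z * f x) :=
    hcs _ (by fun_prop) (by intro x hx; simp [hx])
  have hi2 : Integrable (fun x => z ^ 2 / 2 * (f x : ℂ) ^ 2) :=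
    hcs _ (by fun_prop) (by intro x hx; simp [hx])
  have hi3 : Integrable (fun x => |f x| ^ 3) := by
    refine Continuous.integrable_of_hasCompactSupport (by fun_prop) (hsupp.mono ?_)
    intro x hx hx0
    exact hx (by simp [show f x = 0 from hx0])
  have e : auxJ f z - z ^ 2 / 2 * ((∫ x, f x ^ 2 : ℝ) : ℂ)
      = ∫ x, ((Complex.exp (-z * f x) - 1 + z * f x) - z ^ 2 / 2 * (f x : ℂ) ^ 2) := by
    rw [integral_sub hi1 hi2, integral_const_mul, auxJ, ← integral_complex_ofReal]
    simp
  rw [e, ← integral_const_mul]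
  refine norm_integral_le_of_norm_le (hi3.const_mul _) (Eventually.of_forall fun x => ?_)
  have hb := Complex.norm_exp_sub_sum_le_norm_mul_exp (-z * f x) 3
  have hn : ‖-z * (f x : ℂ)‖ = ‖z‖ * |f x| := by simp
  rw [hn] at hb
  calc ‖(Complex.exp (-z * f x) - 1 + z * f x) - z ^ 2 / 2 * (f x : ℂ) ^ 2‖
      = ‖Complex.exp (-z * f x) - ∑ m ∈ Finset.range 3, (-z * f x) ^ m / (m.factorial : ℂ)‖ := by
        congr 1
        simp [Finset.sum_range_succ, Nat.factorial]
        ring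
    _ ≤ (‖z‖ * |f x|) ^ 3 * Real.exp (‖z‖ * |f x|) := hb
    _ ≤ (‖z‖ * |f x|) ^ 3 * Real.exp (‖z‖ * C) := by
        have := hC x
        rw [Real.norm_eq_abs] at this
        gcongr
    _ = ‖z‖ ^ 3 * Real.exp (‖z‖ * C) * |f x| ^ 3 := by ring

lemma auxJ_tendsto (f : ℝ → ℝ) (hf : Continuous f) (hsupp : HasCompactSupport f)
    (s : ℕ → ℝ) (hs : ∀ᶠ n in atTop, 0 < s n) (hs0 : Tendsto s atTop (𝓝 0)) (z : ℂ) :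
    Tendsto (fun n => (((s n) ^ 2)⁻¹ : ℂ) * auxJ f (z * s n)) atTop
      (𝓝 (z ^ 2 / 2 * ((∫ x, f x ^ 2 : ℝ) : ℂ))) := by
  obtain ⟨C, D, h⟩ := auxJ_bound f hf hsupp
  rw [tendsto_iff_norm_sub_tendsto_zero]
  have hlim : Tendsto (fun n => s n * (‖z‖ ^ 3 * Real.exp (‖z‖ * s n * C) * D)) atTop (𝓝 0) := by
    have hc : Continuous fun u : ℝ => u * (‖z‖ ^ 3 * Real.exp (‖z‖ * u * C) * D) := by fun_prop
    have := (hc.tendsto 0).comp hs0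
    simpa [Function.comp_def] using this
  refine squeeze_zero' (Eventually.of_forall fun n => norm_nonneg _) ?_ hlim
  filter_upwards [hs] with n hn
  have hb := h (z * s n)
  have hn' : (s n : ℂ) ≠ 0 := by exact_mod_cast hn.ne'
  have hz : ‖z * (s n : ℂ)‖ = ‖z‖ * s n := by simp [abs_of_pos hn]
  rw [hz] at hb
  have e : (((s n) ^ 2)⁻¹ : ℂ) * auxJ f (z * s n) - z ^ 2 / 2 * ((∫ x, f x ^ 2 : ℝ) : ℂ)
      = (((s n) ^ 2)⁻¹ : ℂ) * (auxJ f (z * s n)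
        - (z * s n) ^ 2 / 2 * ((∫ x, f x ^ 2 : ℝ) : ℂ)) := by
    field_simp
  have e2 : ‖(((s n) ^ 2)⁻¹ : ℂ)‖ = ((s n) ^ 2)⁻¹ := by simp
  rw [e, norm_mul, e2]
  calc ((s n) ^ 2)⁻¹ * _ ≤ ((s n) ^ 2)⁻¹ * ((‖z‖ * s n) ^ 3 * Real.exp (‖z‖ * s n * C) * D) := by
        gcongr
    _ = _ := by field_simp

/-- Gaussian limit of the laws `√(2π/κ)·L_{f,κ/(2π),σ_f}` as `κ → ∞`: if for each `κ > 0`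
the probability measure `μ κ` is the law of the normalized random variable, identified by its
moment generating function, then `μ κ` converges weakly to `N(0, ∫ f²)` as `κ → ∞`. -/
theorem stmt_14 (f : ℝ → ℝ) (hf : Continuous f) (hsupp : HasCompactSupport f)
    (σf : ℝ) (hσf : 0 ≤ σf)
    (μ : ℝ → ProbabilityMeasure ℝ)
    (hmgf : ∀ κ : ℝ, 0 < κ → ∀ lam : ℝ,
      (∫ x : ℝ, Real.exp (lam * x) ∂(μ κ : Measure ℝ))
        = Real.exp (σf ^ 2 * (2 * Real.pi / κ) * lam ^ 2 / 2 +
            (κ / (2 * Real.pi)) *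
              ∫ x : ℝ, (Real.exp (-(lam * Real.sqrt (2 * Real.pi / κ)) * f x) - 1 +
                (lam * Real.sqrt (2 * Real.pi / κ)) * f x))) :
    Tendsto μ atTop
      (𝓝 (⟨gaussianReal 0 ((∫ x : ℝ, f x ^ 2).toNNReal), inferInstance⟩ :
        ProbabilityMeasure ℝ)) := by
  have hchar : ∀ κ : ℝ, 0 < κ → ∀ z : ℂ, complexMGF id (μ κ : Measure ℝ) z
      = Complex.exp (σf ^ 2 * ((√(2 * π / κ) : ℝ) : ℂ) ^ 2 * z ^ 2 / 2 +
          (((√(2 * π / κ) : ℝ) : ℂ) ^ 2)⁻¹ * auxJ f (z * (√(2 * π / κ) : ℝ))) := by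
    intro κ hκ z
    have hsq : √(2 * π / κ) ^ 2 = 2 * π / κ := Real.sq_sqrt (by positivity)
    have hd := auxJ_differentiable f hf hsupp
    refine congrFun (complexMGF_eq_of_mgf_eq (μ κ : Measure ℝ) (fun z =>
      Complex.exp (σf ^ 2 * ((√(2 * π / κ) : ℝ) : ℂ) ^ 2 * z ^ 2 / 2 +
          (((√(2 * π / κ) : ℝ) : ℂ) ^ 2)⁻¹ * auxJ f (z * (√(2 * π / κ) : ℝ)))) ?_ _ ?_ ?_
      (hmgf κ hκ)) z
    · have h2 : Differentiable ℂ fun z : ℂ => auxJ f (z * (√(2 * π / κ) : ℝ)) :=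
        hd.comp (by fun_prop)
      fun_prop
    · intro t
      rw [← Complex.ofReal_mul, auxJ_ofReal, ← Complex.ofReal_pow √(2 * π / κ), hsq]
      rw [show κ / (2 * π) = (2 * π / κ)⁻¹ by rw [inv_div]]
      push_cast
      rfl
    · intro t
      positivity
  refine tendsto_of_seq_tendsto fun κ hκ => ?_
  refine ProbabilityMeasure.tendsto_iff_tendsto_charFun.2 fun t ↦ ?_
  have hκpos : ∀ᶠ n in atTop, 0 < κ n := hκ.eventually_gt_atTop 0
  have hs0 : Tendsto (fun n => √(2 * π / κ n)) atTop (𝓝 0) := by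
    have := (hκ.const_div_atTop (2 * π)).sqrt
    simpa using this
  have hspos : ∀ᶠ n in atTop, 0 < √(2 * π / κ n) := by
    filter_upwards [hκpos] with n hn
    positivity
  have hJ := auxJ_tendsto f hf hsupp _ hspos hs0 (t * Complex.I)
  have hs0c : Tendsto (fun n => ((√(2 * π / κ n) : ℝ) : ℂ)) atTop (𝓝 ((0 : ℝ) : ℂ)) :=
    (Complex.continuous_ofReal.tendsto 0).comp hs0
  have hA : Tendsto (fun n => (σf : ℂ) ^ 2 * ((√(2 * π / κ n) : ℝ) : ℂ) ^ 2
      * (t * Complex.I) ^ 2 / 2) atTop (𝓝 0) := by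
    have hc : Continuous fun u : ℂ => (σf : ℂ) ^ 2 * u ^ 2 * (t * Complex.I) ^ 2 / 2 := by
      fun_prop
    have := (hc.tendsto _).comp hs0c
    simpa [Function.comp_def] using this
  have hE := (Complex.continuous_exp.tendsto _).comp (hA.add hJ)
  have hnn : 0 ≤ ∫ x : ℝ, f x ^ 2 := integral_nonneg fun x => sq_nonneg _
  have hlim : charFun (gaussianReal 0 ((∫ x : ℝ, f x ^ 2).toNNReal)) t
      = Complex.exp (0 + (t * Complex.I) ^ 2 / 2 * ((∫ x, f x ^ 2 : ℝ) : ℂ)) := by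
    rw [charFun_gaussianReal]
    congr 1
    have hco : (((∫ x : ℝ, f x ^ 2).toNNReal : NNReal) : ℂ) = ((∫ x, f x ^ 2 : ℝ) : ℂ) := by
      exact congrArg Complex.ofReal (Real.coe_toNNReal _ hnn)
    rw [hco, mul_pow, Complex.I_sq]
    simp
    ring
  change Tendsto _ _ (𝓝 (charFun (gaussianReal 0 ((∫ x : ℝ, f x ^ 2).toNNReal)) t))
  rw [hlim]
  refine hE.congr' ?_
  filter_upwards [hκpos] with n hn
  rw [← complexMGF_id_mul_I]
  exact (hchar _ hn _).symm
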